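/- Let b ≥ 2, n ≥ 1, j ∈ {1,…,n} and σ any permutation of {0,…,b−1}. Then ∑_{N=1}^{b^j} φ̃_b^σ(N/b^j) = b^j·(∫_0^1 φ̃_b^σ(x) dx + A_b(j,id)/2), ∑_{N=1}^{b^j} φ̃_{b,1}^σ(N/b^j) = b^j·(∫_0^1 φ̃_{b,1}^σ(x) dx + Ā_b(j,id)/2), and ∑_{N=1}^{b^j} φ̃_{b,2}^σ(N/b^j) = b^j·(∫_0^1 φ̃_{b,2}^σ(x) dx + Ā_b(j,id)/2), where A_b(j,id) = −(b^3+2b)/(36·b^{2j}) if b is even, A_b(j,id) = −(b^3−b)/(36·b^{2j}) if b is odd, Ā_b(j,id) = −(b^3−4b)/(36·b^{2j}) if b is even, and Ā_b(j,id) = −(b^3−b)/(36·b^{2j}) if b is odd. -/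

import Mathlib

open Finset
open scoped Classical

noncomputable section

namespace SymHamm

/-- The reversal permutation `τ(k) = b−1−k` on `{0,…,b−1}`. -/
def tauP (b : ℕ) : Equiv.Perm (Fin b) := Fin.revPerm

/-- `σ̄ = τ ∘ σ`. -/
def pbar {b : ℕ} (σ : Equiv.Perm (Fin b)) : Equiv.Perm (Fin b) := σ.trans (tauP b)

/-- Value of a permutation of `Fin b` on a natural number. -/
def permVal {b : ℕ} (σ : Equiv.Perm (Fin b)) (k : ℕ) : ℕ :=
  if h : k < b then (σ ⟨k, h⟩ : ℕ) else 0

/-- Faure's function `φ_{b,h}^σ`, extended with period 1 to all of `ℝ`.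
For `x ∈ [(k−1)/b, k/b)` (i.e. `k−1 = ⌊b·{x}⌋`), it equals
`A([0,h/b);k;Z_b^σ) − h·x` if `h ≤ σ(k−1)` and `(b−h)·x − A([h/b,1);k;Z_b^σ)` otherwise,
where `A` counts the first `k` entries `σ(0)/b,…,σ(k−1)/b` of `Z_b^σ` in the interval. -/
def phi {b : ℕ} (σ : Equiv.Perm (Fin b)) (h : ℕ) (x : ℝ) : ℝ :=
  if h ≤ permVal σ (⌊(b : ℝ) * Int.fract x⌋).toNat then
    (((Finset.range ((⌊(b : ℝ) * Int.fract x⌋).toNat + 1)).filter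
        (fun l => permVal σ l < h)).card : ℝ) - (h : ℝ) * Int.fract x
  else
    ((b : ℝ) - (h : ℝ)) * Int.fract x -
      (((Finset.range ((⌊(b : ℝ) * Int.fract x⌋).toNat + 1)).filter
        (fun l => h ≤ permVal σ l)).card : ℝ)

/-- `φ_b^σ = ∑_{h=0}^{b−1} φ_{b,h}^σ`. -/
def phiS {b : ℕ} (σ : Equiv.Perm (Fin b)) (x : ℝ) : ℝ := ∑ h ∈ range b, phi σ h x

/-- `φ_b^{σ,(2)} = ∑_{h=0}^{b−1} (φ_{b,h}^σ)²`. -/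
def phiS2 {b : ℕ} (σ : Equiv.Perm (Fin b)) (x : ℝ) : ℝ := ∑ h ∈ range b, (phi σ h x) ^ 2

/-- `φ̃_b^σ = ∑_{h=0}^{b−1} φ_{b,h}^σ · φ_{b,h}^{σ̄}`. -/
def phiT {b : ℕ} (σ : Equiv.Perm (Fin b)) (x : ℝ) : ℝ :=
  ∑ h ∈ range b, phi σ h x * phi (pbar σ) h x

/-- `φ̃_{b,1}^σ = ∑_{h=0}^{b−2} φ_{b,h+1}^σ · φ_{b,h}^{σ̄}`. -/
def phiT1 {b : ℕ} (σ : Equiv.Perm (Fin b)) (x : ℝ) : ℝ :=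
  ∑ h ∈ range (b - 1), phi σ (h + 1) x * phi (pbar σ) h x

/-- `φ̃_{b,2}^σ = ∑_{h=0}^{b−2} φ_{b,h}^σ · φ_{b,h+1}^{σ̄}`. -/
def phiT2 {b : ℕ} (σ : Equiv.Perm (Fin b)) (x : ℝ) : ℝ :=
  ∑ h ∈ range (b - 1), phi σ h x * phi (pbar σ) (h + 1) x

/-- `Φ_b^σ = (1/b)·∫_0^1 φ_b^σ`. -/
def PhiS {b : ℕ} (σ : Equiv.Perm (Fin b)) : ℝ := (1 / (b : ℝ)) * ∫ x in (0:ℝ)..1, phiS σ x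

/-- `Φ_b^{σ,(2)} = (1/b)·∫_0^1 φ_b^{σ,(2)}`. -/
def PhiS2 {b : ℕ} (σ : Equiv.Perm (Fin b)) : ℝ := (1 / (b : ℝ)) * ∫ x in (0:ℝ)..1, phiS2 σ x

/-- `Φ̃_b^σ = (1/b)·∫_0^1 φ̃_b^σ`. -/
def PhiT {b : ℕ} (σ : Equiv.Perm (Fin b)) : ℝ := (1 / (b : ℝ)) * ∫ x in (0:ℝ)..1, phiT σ x

/-- `Φ̃_{b,1}^σ = (1/b)·∫_0^1 φ̃_{b,1}^σ`. -/
def PhiT1 {b : ℕ} (σ : Equiv.Perm (Fin b)) : ℝ := (1 / (b : ℝ)) * ∫ x in (0:ℝ)..1, phiT1 σ x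

/-- `Φ̃_{b,2}^σ = (1/b)·∫_0^1 φ̃_{b,2}^σ`. -/
def PhiT2 {b : ℕ} (σ : Equiv.Perm (Fin b)) : ℝ := (1 / (b : ℝ)) * ∫ x in (0:ℝ)..1, phiT2 σ x

/-- `ν_j(N,Σ) = σ_j(N_j)·b^{n−j−1} + … + σ_{n−1}(N_{n−1})`, where `N_i` is the `i`-th
`b`-adic digit of `N`. -/
def nu (b n : ℕ) (S : Fin n → Equiv.Perm (Fin b)) (N j : ℕ) : ℕ :=
  ∑ i : Fin n,
    if j ≤ (i : ℕ) then permVal (S i) ((N / b ^ (i : ℕ)) % b) * b ^ (n - 1 - (i : ℕ)) else 0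

/-- `ε_j(λ,N,Σ)`, for `1 ≤ j ≤ n`: it is `0` when `λ = bⁿ` or `N = bⁿ`; it is the last digit
`λ_n = λ % b` when `j = n`; otherwise, with `Λ_{j−1} = λ % b^{n−j+1}` and `ν_j = ν_j(N,Σ)`,
it is `0` if `Λ_{j−1} ≤ ν_j`, it is `h` if `ν_j + (h−1)b^{n−j} < Λ_{j−1} ≤ ν_j + h·b^{n−j}`
for some `1 ≤ h < b`, and `0` if `ν_j + (b−1)b^{n−j} < Λ_{j−1} < b^{n−j+1}`. -/
def eps (b n : ℕ) (S : Fin n → Equiv.Perm (Fin b)) (lam N j : ℕ) : ℕ :=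
  if lam = b ^ n ∨ N = b ^ n then 0
  else if j = n then lam % b
  else if lam % b ^ (n - j + 1) ≤ nu b n S N j then 0
  else ((lam % b ^ (n - j + 1) - nu b n S N j - 1) / b ^ (n - j) + 1) % b

/-- The point of the digit-scrambled Hammersley point set `R_{b,n}^Σ` with digits `a`:
`(∑_{j=0}^{n−1} σ_j(a_j)/b^{n−j}, ∑_{j=0}^{n−1} a_j/b^{j+1})`. -/
def hammPt (b n : ℕ) (S : Fin n → Equiv.Perm (Fin b)) (a : Fin n → Fin b) : ℝ × ℝ :=
  (∑ j : Fin n, ((S j (a j) : ℕ) : ℝ) / (b : ℝ) ^ (n - (j : ℕ)),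
   ∑ j : Fin n, ((a j : ℕ) : ℝ) / (b : ℝ) ^ ((j : ℕ) + 1))

/-- The symmetrized Hammersley point set `R_{b,n}^{Σ,sym} = R_{b,n}^Σ ∪ R_{b,n}^{Σ*}`,
a family of `2·bⁿ` points. -/
def symFam (b n : ℕ) (S : Fin n → Equiv.Perm (Fin b)) :
    Bool × (Fin n → Fin b) → ℝ × ℝ :=
  fun p => if p.1 then hammPt b n S p.2 else hammPt b n (fun i => pbar (S i)) p.2

/-- Local discrepancy `E(x,y,P) = #{i : P i ∈ [0,x)×[0,y)} − N·x·y` of a finite family of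
points, where `N` is the number of points. -/
def localDisc {ι : Type} [Fintype ι] (P : ι → ℝ × ℝ) (x y : ℝ) : ℝ :=
  ((Finset.univ.filter
      (fun i => 0 ≤ (P i).1 ∧ (P i).1 < x ∧ 0 ≤ (P i).2 ∧ (P i).2 < y)).card : ℝ)
    - (Fintype.card ι : ℝ) * x * y

/-- `L_2` discrepancy `L2(P) = (1/N)·(∫_0^1∫_0^1 E(x,y,P)² dx dy)^{1/2}`. -/
def L2disc {ι : Type} [Fintype ι] (P : ι → ℝ × ℝ) : ℝ :=
  (1 / (Fintype.card ι : ℝ)) *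
    Real.sqrt (∫ x in (0:ℝ)..1, ∫ y in (0:ℝ)..1, (localDisc P x y) ^ 2)


/-- The slope of `phi σ h` on the cell `[k/b, (k+1)/b]`. -/
def phiSlope {b : ℕ} (σ : Equiv.Perm (Fin b)) (h k : ℕ) : ℝ :=
  (if permVal σ k < h then (b : ℝ) else 0) - h

/-- The value of `phi σ h` at the node `k/b`. -/
def phiNode {b : ℕ} (σ : Equiv.Perm (Fin b)) (h k : ℕ) : ℝ :=
  (((Finset.range k).filter (fun l => permVal σ l < h)).card : ℝ) - h * (k / b)

lemma phiNode_succ {b : ℕ} (hb : 0 < b) (σ : Equiv.Perm (Fin b)) (h k : ℕ) :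
    phiNode σ h (k + 1) = phiNode σ h k + phiSlope σ h k * (1 / b) := by
  have hb' : (b : ℝ) ≠ 0 := by positivity
  unfold phiNode phiSlope
  rw [Finset.range_add_one, Finset.filter_insert]
  split_ifs with hk
  · rw [Finset.card_insert_of_notMem (by simp)]
    push_cast
    field_simp
    ring
  · push_cast
    field_simp
    ring

lemma card_filter_le_permVal {b : ℕ} (σ : Equiv.Perm (Fin b)) (h k : ℕ) :
    (((Finset.range k).filter (fun l => h ≤ permVal σ l)).card : ℝ) =
      k - ((Finset.range k).filter (fun l => permVal σ l < h)).card := by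
  have := Finset.card_filter_add_card_filter_not (s := Finset.range k)
    (fun l => permVal σ l < h)
  simp only [not_lt, Finset.card_range] at this
  rw [eq_sub_iff_add_eq']
  exact_mod_cast this

lemma phi_eq_of_mem_Ico {b : ℕ} (hb : 0 < b) (σ : Equiv.Perm (Fin b)) (h k : ℕ) (hk : k < b)
    {x : ℝ} (hx : x ∈ Set.Ico ((k : ℝ) / b) ((k + 1) / b)) :
    phi σ h x = phiNode σ h k + phiSlope σ h k * (x - k / b) := by
  have hb' : (0 : ℝ) < b := by positivity
  have hkb : (k : ℝ) + 1 ≤ b := by exact_mod_cast hk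
  have hfract : Int.fract x = x := by
    rw [Int.fract_eq_self]
    exact ⟨le_trans (by positivity) hx.1, hx.2.trans_le ((div_le_one hb').2 hkb)⟩
  have hfloor : ⌊(b : ℝ) * x⌋ = (k : ℤ) := by
    rw [Int.floor_eq_iff]
    have h1 := (div_le_iff₀ hb').1 hx.1
    have h2 := (lt_div_iff₀ hb').1 hx.2
    push_cast
    constructor <;> linarith
  have hk' : (k : ℝ) / b * b = k := by field_simp
  unfold phi
  rw [hfract, hfloor, Int.toNat_natCast, card_filter_le_permVal]
  unfold phiNode phiSlope
  rw [Finset.range_add_one, Finset.filter_insert]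
  by_cases hs : h ≤ permVal σ k
  · rw [if_pos hs, if_neg (not_lt.2 hs), if_neg (not_lt.2 hs)]
    ring
  · rw [if_neg hs, if_pos (not_le.1 hs), if_pos (not_le.1 hs),
      Finset.card_insert_of_notMem (by simp)]
    push_cast
    linear_combination hk'

lemma sum_range_comp_permVal {b : ℕ} (σ : Equiv.Perm (Fin b)) (g : ℕ → ℝ) :
    ∑ k ∈ Finset.range b, g (permVal σ k) = ∑ k ∈ Finset.range b, g k := by
  rw [← Fin.sum_univ_eq_sum_range, ← Fin.sum_univ_eq_sum_range,
    ← Equiv.sum_comp σ (fun i : Fin b => g i)]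
  simp [permVal]

lemma phiNode_self {b : ℕ} (hb : 0 < b) (σ : Equiv.Perm (Fin b)) (h : ℕ) (hh : h ≤ b) :
    phiNode σ h b = 0 := by
  have hb' : (b : ℝ) ≠ 0 := by positivity
  have hcard : (((Finset.range b).filter (fun l => permVal σ l < h)).card : ℝ) = h := by
    rw [← Finset.sum_boole, sum_range_comp_permVal σ (fun s => if s < h then (1 : ℝ) else 0),
      Finset.sum_boole]
    have : (Finset.range b).filter (fun l => l < h) = Finset.range h := by
      ext l
      simp only [Finset.mem_filter, Finset.mem_range]
      omega
    rw [this, Finset.card_range]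
  unfold phiNode
  rw [hcard, div_self hb', mul_one, sub_self]

lemma phi_zero {b : ℕ} (hb : 0 < b) (σ : Equiv.Perm (Fin b)) (h : ℕ) : phi σ h 0 = 0 := by
  rw [phi_eq_of_mem_Ico hb σ h 0 hb]
  · simp [phiNode]
  · simp [hb]

lemma phi_one {b : ℕ} (hb : 0 < b) (σ : Equiv.Perm (Fin b)) (h : ℕ) : phi σ h 1 = 0 := by
  rw [← phi_zero hb σ h]
  simp [phi]

lemma phi_eq_of_mem_Icc {b : ℕ} (hb : 0 < b) (σ : Equiv.Perm (Fin b)) (h k : ℕ) (hh : h ≤ b)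
    (hk : k < b) {x : ℝ} (hx : x ∈ Set.Icc ((k : ℝ) / b) ((k + 1) / b)) :
    phi σ h x = phiNode σ h k + phiSlope σ h k * (x - k / b) := by
  have hb' : (0 : ℝ) < b := by positivity
  rcases hx.2.lt_or_eq with hlt | rfl
  · exact phi_eq_of_mem_Ico hb σ h k hk ⟨hx.1, hlt⟩
  have hnode : phi σ h (((k : ℝ) + 1) / b) = phiNode σ h (k + 1) := by
    rcases (Nat.succ_le_of_lt hk).lt_or_eq with hlt | heq
    · rw [phi_eq_of_mem_Ico hb σ h (k + 1) hlt]
      · push_cast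
        ring
      · push_cast
        exact ⟨le_rfl, by gcongr; linarith⟩
    · have heq' : (k : ℝ) + 1 = b := by exact_mod_cast heq
      rw [heq', div_self hb'.ne', phi_one hb, show k + 1 = b from heq, phiNode_self hb σ h hh]
  rw [hnode, phiNode_succ hb]
  ring

/-- The error of the trapezoidal rule for a quadratic polynomial. -/
lemma trapezoid_sub_integral_quadratic (p q r c u d : ℝ) :
    ((p + q * (u - c) + r * (u - c) ^ 2) + (p + q * (u + d - c) + r * (u + d - c) ^ 2)) / 2 * d -
      ∫ x in u..(u + d), (p + q * (x - c) + r * (x - c) ^ 2) = r * d ^ 3 / 6 := by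
  have hderiv : ∀ x ∈ Set.uIcc u (u + d),
      HasDerivAt (fun x => p * x + q * (x - c) ^ 2 / 2 + r * (x - c) ^ 3 / 3)
        (p + q * (x - c) + r * (x - c) ^ 2) x := by
    intro x _
    have h1 : HasDerivAt (fun x : ℝ => x - c) 1 x := (hasDerivAt_id x).sub_const c
    refine ((((hasDerivAt_id x).const_mul p).add (((h1.pow 2).const_mul q).div_const 2)).add
      (((h1.pow 3).const_mul r).div_const 3)).congr_deriv ?_
    norm_num
    ring
  rw [intervalIntegral.integral_eq_sub_of_hasDerivAt hderiv
    (Continuous.intervalIntegrable (by fun_prop) _ _)]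
  ring

lemma sum_range_mul_comp_div (r : ℕ → ℝ) (b M : ℕ) (hM : 0 < M) :
    ∑ N ∈ Finset.range (b * M), r (N / M) = M * ∑ k ∈ Finset.range b, r k := by
  induction b with
  | zero => simp
  | succ b ih =>
    rw [add_mul, one_mul, Finset.sum_range_add, ih, Finset.sum_range_succ, mul_add]
    congr 1
    rw [Finset.sum_congr rfl (g := fun _ => r b)]
    · simp
    · intro i hi
      rw [add_comm, Nat.add_mul_div_right _ _ hM, Nat.div_eq_of_lt (Finset.mem_range.1 hi),
        zero_add]

/-- The equidistant rule with `b * M` nodes for a periodic function that is quadratic on each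
of the cells `[k/b, (k+1)/b]`. -/
lemma sum_eq_of_piecewise_quadratic {b M : ℕ} (hb : 0 < b) (hM : 0 < M) (f : ℝ → ℝ)
    (p q r : ℕ → ℝ) (hf01 : f 0 = f 1)
    (hf : ∀ k < b, ∀ x ∈ Set.Icc ((k : ℝ) / b) ((k + 1) / b),
      f x = p k + q k * (x - k / b) + r k * (x - k / b) ^ 2) :
    ∑ N ∈ Finset.Icc 1 (b * M), f ((N : ℝ) / (b * M : ℕ)) =
      (b * M : ℕ) * ((∫ x in (0 : ℝ)..1, f x) +
        (∑ k ∈ Finset.range b, r k) / (6 * b * ((b * M : ℕ) : ℝ) ^ 2)) := by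
  have hb' : (0 : ℝ) < b := by positivity
  have hM' : (0 : ℝ) < M := by positivity
  set n := b * M with hn
  have hn0 : (0 : ℝ) < n := by rw [hn]; push_cast; positivity
  have hnb : (n : ℝ) = b * M := by rw [hn]; push_cast; ring
  have hcell : ∀ N < n, N / M < b ∧
      Set.Icc ((N : ℝ) / n) ((N + 1 : ℕ) / n) ⊆
        Set.Icc (((N / M : ℕ) : ℝ) / b) (((N / M : ℕ) + 1) / b) := by
    intro N hN
    refine ⟨(Nat.div_lt_iff_lt_mul hM).2 hN, Set.Icc_subset_Icc ?_ ?_⟩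
    · rw [div_le_div_iff₀ hb' hn0, hnb]
      have : ((N / M * M : ℕ) : ℝ) ≤ N := by exact_mod_cast Nat.div_mul_le_self N M
      push_cast at this
      nlinarith
    · rw [div_le_div_iff₀ hn0 hb', hnb]
      have : ((N + 1 : ℕ) : ℝ) ≤ ((N / M + 1) * M : ℕ) := by
        exact_mod_cast Nat.lt_mul_of_div_lt (Nat.lt_succ_self _) hM
      push_cast at this ⊢
      nlinarith
  have hle : ∀ N : ℕ, (N : ℝ) / n ≤ (N + 1 : ℕ) / n := fun N => by gcongr; omega
  have hint : ∀ N < n, IntervalIntegrable f MeasureTheory.volume ((N : ℝ) / n)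
      ((N + 1 : ℕ) / n) := by
    intro N hN
    obtain ⟨h1, h2⟩ := hcell N hN
    refine ContinuousOn.intervalIntegrable ?_
    rw [Set.uIcc_of_le (hle N)]
    refine ContinuousOn.congr (Continuous.continuousOn ?_) (fun x hx => hf _ h1 x (h2 hx))
    fun_prop
  have hstep : ∀ N < n, (f (N / n) + f ((N + 1 : ℕ) / n)) / 2 * (1 / n) =
      (∫ x in ((N : ℝ) / n)..((N + 1 : ℕ) / n), f x) + r (N / M) * (1 / n) ^ 3 / 6 := by
    intro N hN
    obtain ⟨h1, h2⟩ := hcell N hN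
    have hu : ((N + 1 : ℕ) : ℝ) / n = N / n + 1 / n := by push_cast; ring
    have hint : ∫ x in ((N : ℝ) / n)..((N + 1 : ℕ) / n), f x =
        ∫ x in ((N : ℝ) / n)..((N + 1 : ℕ) / n), (p (N / M) + q (N / M) * (x - (N / M : ℕ) / b) +
          r (N / M) * (x - (N / M : ℕ) / b) ^ 2) := by
      refine intervalIntegral.integral_congr fun x hx => ?_
      rw [Set.uIcc_of_le (hle N)] at hx
      exact hf _ h1 x (h2 hx)
    rw [hint, hf _ h1 _ (h2 (Set.left_mem_Icc.2 (hle N))),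
      hf _ h1 _ (h2 (Set.right_mem_Icc.2 (hle N))), hu, ← sub_eq_iff_eq_add',
      trapezoid_sub_integral_quadratic]
  have htotal := Finset.sum_congr rfl fun N hN => hstep N (Finset.mem_range.1 hN)
  rw [Finset.sum_add_distrib, intervalIntegral.sum_integral_adjacent_intervals
    (a := fun N : ℕ => (N : ℝ) / n) (fun N hN => hint N hN), ← Finset.sum_div, ← Finset.sum_mul,
    ← Finset.sum_mul, ← Finset.sum_div, Finset.sum_add_distrib,
    sum_range_mul_comp_div r b M hM] at htotal
  have hshift : ∑ N ∈ Finset.range n, f ((N : ℝ) / n) =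
      ∑ N ∈ Finset.range n, f (((N + 1 : ℕ) : ℝ) / n) := by
    have h1 := Finset.sum_range_succ (fun N : ℕ => f ((N : ℝ) / n)) n
    have h2 := Finset.sum_range_succ' (fun N : ℕ => f ((N : ℝ) / n)) n
    rw [div_self hn0.ne'] at h1
    rw [Nat.cast_zero, zero_div] at h2
    linarith
  have hIcc : ∑ N ∈ Finset.Icc 1 n, f ((N : ℝ) / n) =
      ∑ N ∈ Finset.range n, f (((N + 1 : ℕ) : ℝ) / n) := by
    rw [Finset.range_eq_Ico, Finset.sum_Ico_add' (fun N : ℕ => f ((N : ℝ) / n)) 0 n 1]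
    rfl
  rw [Nat.cast_zero, zero_div, div_self hn0.ne', hshift, ← hIcc, add_self_div_two] at htotal
  rw [mul_one_div, div_eq_iff hn0.ne'] at htotal
  rw [htotal, hnb]
  field_simp

/-- The equidistant rule for a sum of products of functions `phi`. -/
lemma sum_phi_mul_phi {b j : ℕ} (hb : 0 < b) (hj : 1 ≤ j) (σ ρ : Equiv.Perm (Fin b))
    {ι : Type*} (s : Finset ι) (u v : ι → ℕ) (hu : ∀ i ∈ s, u i ≤ b) (hv : ∀ i ∈ s, v i ≤ b) :
    ∑ N ∈ Finset.Icc 1 (b ^ j), ∑ i ∈ s, phi σ (u i) ((N : ℝ) / (b : ℝ) ^ j) *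
        phi ρ (v i) ((N : ℝ) / (b : ℝ) ^ j) =
      (b : ℝ) ^ j * ((∫ x in (0 : ℝ)..1, ∑ i ∈ s, phi σ (u i) x * phi ρ (v i) x) +
        (∑ i ∈ s, ∑ k ∈ Finset.range b, phiSlope σ (u i) k * phiSlope ρ (v i) k) /
          (6 * b * (b : ℝ) ^ (2 * j))) := by
  have hpow : b * b ^ (j - 1) = b ^ j := by rw [← pow_succ', Nat.sub_add_cancel hj]
  have key := sum_eq_of_piecewise_quadratic (M := b ^ (j - 1)) hb (by positivity)
    (fun x => ∑ i ∈ s, phi σ (u i) x * phi ρ (v i) x)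
    (fun k => ∑ i ∈ s, phiNode σ (u i) k * phiNode ρ (v i) k)
    (fun k => ∑ i ∈ s, (phiNode σ (u i) k * phiSlope ρ (v i) k +
      phiSlope σ (u i) k * phiNode ρ (v i) k))
    (fun k => ∑ i ∈ s, phiSlope σ (u i) k * phiSlope ρ (v i) k)
    (by simp [phi_zero hb, phi_one hb]) ?_
  · rw [hpow, Finset.sum_comm (s := Finset.range b)] at key
    push_cast at key
    rw [key, ← pow_mul, mul_comm j 2]
  · intro k hk x hx
    simp only [Finset.sum_mul, ← Finset.sum_add_distrib]
    refine Finset.sum_congr rfl fun i hi => ?_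
    rw [phi_eq_of_mem_Icc hb σ _ k (hu i hi) hk hx, phi_eq_of_mem_Icc hb ρ _ k (hv i hi) hk hx]
    ring

lemma permVal_pbar {b : ℕ} (σ : Equiv.Perm (Fin b)) {k : ℕ} (hk : k < b) :
    permVal (pbar σ) k = b - 1 - permVal σ k := by
  simp only [permVal, hk, dif_pos, pbar, tauP, Equiv.trans_apply, Fin.revPerm_apply, Fin.val_rev]
  omega

lemma sum_phiSlope_mul_phiSlope_pbar {b : ℕ} (σ : Equiv.Perm (Fin b)) {u v : ℕ} (hu : u ≤ b)
    (hv : v ≤ b) :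
    ∑ k ∈ Finset.range b, phiSlope σ u k * phiSlope (pbar σ) v k =
      (b : ℝ) ^ 2 * (u + v - b : ℕ) - b * u * v := by
  have hperm : ∀ k ∈ Finset.range b, phiSlope σ u k * phiSlope (pbar σ) v k =
      (fun s => ((if s < u then (b : ℝ) else 0) - u) *
        ((if b - 1 - s < v then (b : ℝ) else 0) - v)) (permVal σ k) := by
    intro k hk
    simp only [phiSlope, permVal_pbar σ (Finset.mem_range.1 hk)]
  rw [Finset.sum_congr rfl hperm, sum_range_comp_permVal σ (fun s =>
    ((if s < u then (b : ℝ) else 0) - u) * ((if b - 1 - s < v then (b : ℝ) else 0) - v))]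
  have h1 : (Finset.range b).filter (fun s => s < u ∧ b - 1 - s < v) = Finset.Ico (b - v) u := by
    ext s
    simp only [Finset.mem_filter, Finset.mem_range, Finset.mem_Ico]
    omega
  have h2 : (Finset.range b).filter (fun s => s < u) = Finset.range u := by
    ext s
    simp only [Finset.mem_filter, Finset.mem_range]
    omega
  have h3 : (Finset.range b).filter (fun s => b - 1 - s < v) = Finset.Ico (b - v) b := by
    ext s
    simp only [Finset.mem_filter, Finset.mem_range, Finset.mem_Ico]
    omega
  have hexp : ∀ s ∈ Finset.range b, ((if s < u then (b : ℝ) else 0) - u) *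
        ((if b - 1 - s < v then (b : ℝ) else 0) - v) =
      (b : ℝ) ^ 2 * (if s < u ∧ b - 1 - s < v then 1 else 0) - b * v * (if s < u then 1 else 0)
        - b * u * (if b - 1 - s < v then 1 else 0) + u * v := by
    intro s _
    by_cases hsu : s < u <;> by_cases hsv : b - 1 - s < v <;> simp [hsu, hsv] <;> ring
  rw [Finset.sum_congr rfl hexp]
  simp only [Finset.sum_add_distrib, Finset.sum_sub_distrib, ← Finset.mul_sum, Finset.sum_boole,
    h1, h2, h3, Finset.sum_const, Nat.card_Ico, Finset.card_range, nsmul_eq_mul]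
  rw [show u - (b - v) = u + v - b by omega, show b - (b - v) = v by omega]
  ring

lemma sum_range_two_mul (m : ℕ) : ∑ i ∈ Finset.range m, (2 * i : ℝ) = m * (m - 1) := by
  induction m with
  | zero => simp
  | succ m ih => rw [Finset.sum_range_succ, ih]; push_cast; ring

lemma sum_range_two_mul_add_one (m : ℕ) : ∑ i ∈ Finset.range m, (2 * i + 1 : ℝ) = m ^ 2 := by
  induction m with
  | zero => simp
  | succ m ih => rw [Finset.sum_range_succ, ih]; push_cast; ring

/-- Discards the leading terms that vanish by truncated subtraction. -/
lemma sum_range_add_cast_tsub (l m d : ℕ) (e : ℕ) (he : ∀ i < l, 2 * i + e ≤ d) :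
    ∑ i ∈ Finset.range (l + m), ((2 * i + e - d : ℕ) : ℝ) =
      ∑ i ∈ Finset.range m, ((2 * (l + i) + e - d : ℕ) : ℝ) := by
  rw [Finset.sum_range_add, Finset.sum_eq_zero, zero_add]
  intro i hi
  rw [Nat.sub_eq_zero_of_le (he i (Finset.mem_range.1 hi)), Nat.cast_zero]

lemma sum_range_sq (b : ℕ) :
    ∑ h ∈ Finset.range b, (h : ℝ) * h = b * (b - 1) * (2 * b - 1) / 6 := by
  induction b with
  | zero => simp
  | succ b ih => rw [Finset.sum_range_succ, ih]; push_cast; ring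

lemma sum_range_mul_succ (b : ℕ) :
    ∑ h ∈ Finset.range b, (h : ℝ) * (h + 1) = (b - 1) * b * (b + 1) / 3 := by
  induction b with
  | zero => simp
  | succ b ih => rw [Finset.sum_range_succ, ih]; push_cast; ring

lemma sum_range_two_mul_sub (b : ℕ) :
    ∑ h ∈ Finset.range b, ((h + h - b : ℕ) : ℝ) =
      if Even b then (b : ℝ) * (b - 2) / 4 else ((b : ℝ) - 1) ^ 2 / 4 := by
  simp only [← two_mul]
  split_ifs with hb
  · obtain ⟨m, rfl⟩ := hb
    have := sum_range_add_cast_tsub m m (m + m) 0 (by omega)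
    simp only [add_zero] at this
    rw [this, Finset.sum_congr rfl (g := fun i : ℕ => (2 * i : ℝ)), sum_range_two_mul]
    · push_cast
      ring
    · intro i _
      rw [show 2 * (m + i) - (m + m) = 2 * i by omega]
      push_cast
      ring
  · obtain ⟨m, rfl⟩ := Nat.not_even_iff_odd.1 hb
    have := sum_range_add_cast_tsub (m + 1) m (2 * m + 1) 0 (by omega)
    simp only [add_zero] at this
    rw [show Finset.range (2 * m + 1) = Finset.range (m + 1 + m) by congr 1; omega, this,
      Finset.sum_congr rfl (g := fun i : ℕ => (2 * i + 1 : ℝ)), sum_range_two_mul_add_one]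
    · push_cast
      ring
    · intro i _
      rw [show 2 * (m + 1 + i) - (2 * m + 1) = 2 * i + 1 by omega]
      push_cast
      ring

lemma sum_range_two_mul_add_one_sub (b : ℕ) (hb : 0 < b) :
    ∑ h ∈ Finset.range (b - 1), ((2 * h + 1 - b : ℕ) : ℝ) =
      if Even b then ((b : ℝ) - 2) ^ 2 / 4 else ((b : ℝ) - 1) * (b - 3) / 4 := by
  split_ifs with he
  · obtain ⟨m, rfl⟩ := he
    obtain ⟨m, rfl⟩ : ∃ l, m = l + 1 := ⟨m - 1, by omega⟩
    rw [show m + 1 + (m + 1) - 1 = (m + 1) + m by omega,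
      sum_range_add_cast_tsub (m + 1) m (m + 1 + (m + 1)) 1 (by omega),
      Finset.sum_congr rfl (g := fun i : ℕ => (2 * i + 1 : ℝ)), sum_range_two_mul_add_one]
    · push_cast
      ring
    · intro i _
      rw [show 2 * (m + 1 + i) + 1 - (m + 1 + (m + 1)) = 2 * i + 1 by omega]
      push_cast
      ring
  · obtain ⟨m, rfl⟩ := Nat.not_even_iff_odd.1 he
    rw [show 2 * m + 1 - 1 = m + m by omega,
      sum_range_add_cast_tsub m m (2 * m + 1) 1 (by omega),
      Finset.sum_congr rfl (g := fun i : ℕ => (2 * i : ℝ)), sum_range_two_mul]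
    · push_cast
      ring
    · intro i _
      rw [show 2 * (m + i) + 1 - (2 * m + 1) = 2 * i by omega]
      push_cast
      ring

lemma sum_slopes_phiT {b : ℕ} (σ : Equiv.Perm (Fin b)) :
    ∑ h ∈ Finset.range b, ∑ k ∈ Finset.range b, phiSlope σ h k * phiSlope (pbar σ) h k =
      if Even b then -(b : ℝ) ^ 2 * (b ^ 2 + 2) / 12 else -(b : ℝ) ^ 2 * (b ^ 2 - 1) / 12 := by
  rw [Finset.sum_congr rfl fun h hh => sum_phiSlope_mul_phiSlope_pbar σ
    (Finset.mem_range.1 hh).le (Finset.mem_range.1 hh).le]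
  simp only [Finset.sum_sub_distrib, ← Finset.mul_sum, mul_assoc, sum_range_two_mul_sub,
    sum_range_sq]
  split_ifs <;> ring

lemma sum_shifted_slopes {b : ℕ} (hb : 0 < b) :
    ∑ h ∈ Finset.range (b - 1), ((b : ℝ) ^ 2 * (2 * h + 1 - b : ℕ) - b * (h * (h + 1))) =
      if Even b then -(b : ℝ) ^ 2 * (b ^ 2 - 4) / 12 else -(b : ℝ) ^ 2 * (b ^ 2 - 1) / 12 := by
  rw [Finset.sum_sub_distrib, ← Finset.mul_sum, ← Finset.mul_sum,
    sum_range_two_mul_add_one_sub b hb, sum_range_mul_succ, Nat.cast_sub hb]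
  split_ifs <;> push_cast <;> ring

lemma sum_slopes_phiT1 {b : ℕ} (hb : 0 < b) (σ : Equiv.Perm (Fin b)) :
    ∑ h ∈ Finset.range (b - 1), ∑ k ∈ Finset.range b,
        phiSlope σ (h + 1) k * phiSlope (pbar σ) h k =
      if Even b then -(b : ℝ) ^ 2 * (b ^ 2 - 4) / 12 else -(b : ℝ) ^ 2 * (b ^ 2 - 1) / 12 := by
  rw [← sum_shifted_slopes hb]
  refine Finset.sum_congr rfl fun h hh => ?_
  have := Finset.mem_range.1 hh
  rw [sum_phiSlope_mul_phiSlope_pbar σ (by omega) (by omega),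
    show h + 1 + h = 2 * h + 1 by ring]
  push_cast
  ring

lemma sum_slopes_phiT2 {b : ℕ} (hb : 0 < b) (σ : Equiv.Perm (Fin b)) :
    ∑ h ∈ Finset.range (b - 1), ∑ k ∈ Finset.range b,
        phiSlope σ h k * phiSlope (pbar σ) (h + 1) k =
      if Even b then -(b : ℝ) ^ 2 * (b ^ 2 - 4) / 12 else -(b : ℝ) ^ 2 * (b ^ 2 - 1) / 12 := by
  rw [← sum_shifted_slopes hb]
  refine Finset.sum_congr rfl fun h hh => ?_
  have := Finset.mem_range.1 hh
  rw [sum_phiSlope_mul_phiSlope_pbar σ (by omega) (by omega),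
    show h + (h + 1) = 2 * h + 1 by ring]
  push_cast
  ring

theorem stmt9 (b : ℕ) (hb : 2 ≤ b) (n : ℕ) (hn : 1 ≤ n)
    (j : ℕ) (hj1 : 1 ≤ j) (hj2 : j ≤ n) (σ : Equiv.Perm (Fin b)) :
    (∑ N ∈ Finset.Icc 1 (b ^ j), phiT σ ((N : ℝ) / (b : ℝ) ^ j) =
        (b : ℝ) ^ j * ((∫ x in (0:ℝ)..1, phiT σ x)
          + (if Even b then -((b : ℝ) ^ 3 + 2 * (b : ℝ)) / (36 * (b : ℝ) ^ (2 * j))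
              else -((b : ℝ) ^ 3 - (b : ℝ)) / (36 * (b : ℝ) ^ (2 * j))) / 2))
      ∧ (∑ N ∈ Finset.Icc 1 (b ^ j), phiT1 σ ((N : ℝ) / (b : ℝ) ^ j) =
          (b : ℝ) ^ j * ((∫ x in (0:ℝ)..1, phiT1 σ x)
            + (if Even b then -((b : ℝ) ^ 3 - 4 * (b : ℝ)) / (36 * (b : ℝ) ^ (2 * j))
                else -((b : ℝ) ^ 3 - (b : ℝ)) / (36 * (b : ℝ) ^ (2 * j))) / 2))
      ∧ (∑ N ∈ Finset.Icc 1 (b ^ j), phiT2 σ ((N : ℝ) / (b : ℝ) ^ j) =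
          (b : ℝ) ^ j * ((∫ x in (0:ℝ)..1, phiT2 σ x)
            + (if Even b then -((b : ℝ) ^ 3 - 4 * (b : ℝ)) / (36 * (b : ℝ) ^ (2 * j))
                else -((b : ℝ) ^ 3 - (b : ℝ)) / (36 * (b : ℝ) ^ (2 * j))) / 2)) := by
  have hb0 : 0 < b := by omega
  have hb' : (b : ℝ) ≠ 0 := by positivity
  have hlt : ∀ h ∈ Finset.range (b - 1), h + 1 ≤ b := fun h hh => by
    have := Finset.mem_range.1 hh
    omega
  refine ⟨?_, ?_, ?_⟩
  · have hle : ∀ h ∈ Finset.range b, h ≤ b := fun h hh => (Finset.mem_range.1 hh).le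
    refine (sum_phi_mul_phi hb0 hj1 σ (pbar σ) (Finset.range b) (fun h => h) (fun h => h)
      hle hle).trans ?_
    rw [sum_slopes_phiT]
    unfold phiT
    split_ifs <;> congr 2 <;> field_simp <;> ring
  · refine (sum_phi_mul_phi hb0 hj1 σ (pbar σ) (Finset.range (b - 1)) (fun h => h + 1)
      (fun h => h) hlt (fun h hh => (Nat.le_succ h).trans (hlt h hh))).trans ?_
    rw [sum_slopes_phiT1 hb0]
    unfold phiT1
    split_ifs <;> congr 2 <;> field_simp <;> ring
  · refine (sum_phi_mul_phi hb0 hj1 σ (pbar σ) (Finset.range (b - 1)) (fun h => h)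
      (fun h => h + 1) (fun h hh => (Nat.le_succ h).trans (hlt h hh)) hlt).trans ?_
    rw [sum_slopes_phiT2 hb0]
    unfold phiT2
    split_ifs <;> congr 2 <;> field_simp <;> ring

end SymHamm
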